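/- Let 0 < α < 1, 0 ≤ μ < 1. If f ∈ C_μ[a,b] and I_{a+}^{1-α} f ∈ C_μ^1[a,b] (i.e., I_{a+}^{1-α} f is continuously differentiable on (a,b] with derivative in C_μ[a,b]), then for all x ∈ (a,b], I_{a+}^α D_{a+}^α f(x) = f(x) - (I_{a+}^{1-α} f)(a+)/Γ(α) · (x-a)^{α-1}. -/

import Mathlib

open Real Set MeasureTheory intervalIntegral Filter

/-- Riemann–Liouville fractional integral of order `α > 0` based at `a`. -/
noncomputable def RLint (a α : ℝ) (f : ℝ → ℝ) (x : ℝ) : ℝ :=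
  if α = 0 then f x else (1 / Real.Gamma α) * ∫ t in a..x, (x - t) ^ (α - 1) * f t

/-- `f ∈ C_μ[a,b]`: the weighted function `(x-a)^μ f(x)` on `(a,b]` extends
continuously to `[a,b]`. -/
def MemCmu (a b μ : ℝ) (f : ℝ → ℝ) : Prop :=
  ∃ F : ℝ → ℝ, ContinuousOn F (Set.Icc a b) ∧
    ∀ x ∈ Set.Ioc a b, F x = (x - a) ^ μ * f x

theorem intervalIntegrable_sub_rpow {s x q : ℝ} (hq : 0 < q) :
    IntervalIntegrable (fun t => (t - s) ^ (q - 1)) volume s x := by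
  have h := (intervalIntegrable_rpow' (a := 0) (b := x - s)
    (show -1 < q - 1 by linarith)).comp_sub_right s
  simpa using h

theorem intervalIntegrable_rsub_rpow {s x p : ℝ} (hp : 0 < p) :
    IntervalIntegrable (fun t => (x - t) ^ (p - 1)) volume s x := by
  have h := (intervalIntegrable_rpow' (a := x - s) (b := 0)
    (show -1 < p - 1 by linarith)).comp_sub_left x
  simpa using h

theorem intervalIntegrable_rsub_rpow_mul_sub_rpow {s x p q : ℝ} (hsx : s < x)
    (hp : 0 < p) (hq : 0 < q) :
    IntervalIntegrable (fun t => (x - t) ^ (p - 1) * (t - s) ^ (q - 1)) volume s x := by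
  have hm : s < (s + x) / 2 ∧ (s + x) / 2 < x := ⟨by linarith, by linarith⟩
  refine IntervalIntegrable.trans (b := (s + x) / 2) ?_ ?_
  · refine (intervalIntegrable_sub_rpow hq).continuousOn_mul ?_
    rw [uIcc_of_le hm.1.le]
    exact ContinuousOn.rpow_const (by fun_prop) fun t ht => Or.inl (by linarith [ht.2, hm.2])
  · refine (intervalIntegrable_rsub_rpow hp).mul_continuousOn ?_
    rw [uIcc_of_le hm.2.le]
    exact ContinuousOn.rpow_const (by fun_prop) fun t ht => Or.inl (by linarith [ht.1, hm.1])

theorem integral_eq_mul_integral_unit (k : ℝ → ℝ) (s x : ℝ) :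
    ∫ t in s..x, k t = (x - s) * ∫ u in (0 : ℝ)..1, k (s + (x - s) * u) := by
  simp

theorem integral_rpow_mul_one_sub_rpow {p q : ℝ} (hp : 0 < p) (hq : 0 < q) :
    ∫ u in (0 : ℝ)..1, (1 - u) ^ (p - 1) * u ^ (q - 1) = ProbabilityTheory.beta p q := by
  have hc : ((∫ u in (0 : ℝ)..1, (1 - u) ^ (p - 1) * u ^ (q - 1) : ℝ) : ℂ)
      = Complex.betaIntegral q p := by
    rw [← intervalIntegral.integral_ofReal, Complex.betaIntegral]
    refine intervalIntegral.integral_congr fun u hu => ?_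
    rw [uIcc_of_le zero_le_one] at hu
    push_cast [Complex.ofReal_cpow hu.1, Complex.ofReal_cpow (sub_nonneg.2 hu.2)]
    ring
  rw [ProbabilityTheory.beta_eq_betaIntegralReal p q hp hq, Complex.betaIntegral_symm, ← hc,
    Complex.ofReal_re]

theorem integral_rsub_rpow_mul_sub_rpow {s x p q : ℝ} (hsx : s < x) (hp : 0 < p) (hq : 0 < q) :
    ∫ t in s..x, (x - t) ^ (p - 1) * (t - s) ^ (q - 1)
      = (x - s) ^ (p + q - 1) * ProbabilityTheory.beta p q := by
  have h0 : 0 < x - s := sub_pos.2 hsx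
  rw [integral_eq_mul_integral_unit, ← integral_rpow_mul_one_sub_rpow hp hq,
    ← intervalIntegral.integral_const_mul, ← intervalIntegral.integral_const_mul]
  refine intervalIntegral.integral_congr fun u hu => ?_
  rw [uIcc_of_le zero_le_one] at hu
  have e1 : x - (s + (x - s) * u) = (x - s) * (1 - u) := by ring
  have e2 : s + (x - s) * u - s = (x - s) * u := by ring
  have e3 : (x - s) ^ (p + q - 1) = (x - s) * ((x - s) ^ (p - 1) * (x - s) ^ (q - 1)) := by
    nth_rewrite 2 [← Real.rpow_one (x - s)]
    rw [← Real.rpow_add h0, ← Real.rpow_add h0]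
    ring_nf
  simp only [e1, e2, e3]
  rw [Real.mul_rpow h0.le (sub_nonneg.2 hu.2), Real.mul_rpow h0.le hu.1]
  ring

theorem setIntegral_Ioc_indicator_Ioi {a s x : ℝ} (hs : s ∈ Ioc a x) (k : ℝ → ℝ) :
    ∫ t in Ioc a x, (Ioi s).indicator k t = ∫ t in s..x, k t := by
  rw [setIntegral_indicator measurableSet_Ioi, integral_of_le hs.2, Ioc_inter_Ioi,
    sup_eq_right.2 hs.1.le]

theorem integral_rsub_rpow_mul_integral {a x p q : ℝ} {h : ℝ → ℝ} (hax : a ≤ x) (hp : 0 < p)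
    (hq : 0 < q) (hpq : 1 ≤ p + q) (hh : IntervalIntegrable h volume a x) :
    ∫ t in a..x, (x - t) ^ (p - 1) * ∫ s in a..t, (t - s) ^ (q - 1) * h s
      = ProbabilityTheory.beta p q * ∫ s in a..x, (x - s) ^ (p + q - 1) * h s := by
  set k : ℝ → ℝ → ℝ := fun t s =>
    (Ioi s).indicator (fun t => (x - t) ^ (p - 1) * (t - s) ^ (q - 1) * h s) t with hk
  have hmeas : AEStronglyMeasurable (Function.uncurry k)
      ((volume.restrict (Ioc a x)).prod (volume.restrict (Ioc a x))) := by
    have h1 : Function.uncurry k = {z : ℝ × ℝ | z.2 < z.1}.indicator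
        (fun z => (x - z.1) ^ (p - 1) * (z.1 - z.2) ^ (q - 1) * h z.2) := by
      ext ⟨t, s⟩
      simp [hk, Function.uncurry, indicator]
    rw [h1]
    refine AEStronglyMeasurable.indicator ?_ (measurableSet_lt measurable_snd measurable_fst)
    have hs : AEStronglyMeasurable (fun z : ℝ × ℝ => h z.2)
        ((volume.restrict (Ioc a x)).prod (volume.restrict (Ioc a x))) :=
      hh.1.aestronglyMeasurable.comp_snd
    refine AEStronglyMeasurable.mul ?_ hs
    exact Measurable.aestronglyMeasurable (by fun_prop)
  have hsec : ∀ s ∈ Ioo a x, IntegrableOn (fun t => k t s) (Ioc a x) := by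
    intro s hs
    rw [hk, integrableOn_indicator_iff measurableSet_Ioi, inter_comm, Ioc_inter_Ioi,
      sup_eq_right.2 hs.1.le]
    exact ((intervalIntegrable_rsub_rpow_mul_sub_rpow hs.2 hp hq).mul_const (h s)).1
  have hIoo : ∀ᵐ s ∂(volume.restrict (Ioc a x)), s ∈ Ioo a x := by
    rw [← restrict_Ioo_eq_restrict_Ioc]
    exact ae_restrict_mem measurableSet_Ioo
  have hker : IntervalIntegrable (fun s => (x - s) ^ (p + q - 1) * h s) volume a x :=
    hh.continuousOn_mul
      (ContinuousOn.rpow_const (by fun_prop) fun t _ => Or.inr (by linarith))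
  have hint : Integrable (Function.uncurry k)
      ((volume.restrict (Ioc a x)).prod (volume.restrict (Ioc a x))) := by
    rw [integrable_prod_iff' hmeas]
    refine ⟨hIoo.mono hsec, ?_⟩
    refine ((hker.1.norm).mul_const (ProbabilityTheory.beta p q)).congr ?_
    filter_upwards [hIoo] with s hs
    have h1 : ∀ t ∈ Ioc a x, ‖Function.uncurry k (t, s)‖ = (Ioi s).indicator
        (fun t => (x - t) ^ (p - 1) * (t - s) ^ (q - 1) * ‖h s‖) t := by
      intro t ht
      simp only [Function.uncurry, hk, indicator]
      split_ifs with hst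
      · have : 0 ≤ t - s := sub_nonneg.2 (le_of_lt hst)
        have : 0 ≤ x - t := sub_nonneg.2 ht.2
        rw [norm_mul, Real.norm_of_nonneg (by positivity)]
      · exact norm_zero
    rw [setIntegral_congr_fun measurableSet_Ioc h1,
      setIntegral_Ioc_indicator_Ioi (Ioo_subset_Ioc_self hs),
      intervalIntegral.integral_mul_const, integral_rsub_rpow_mul_sub_rpow hs.2 hp hq, norm_mul,
      Real.norm_of_nonneg (Real.rpow_nonneg (sub_nonneg.2 hs.2.le) _)]
    ring
  have hswap := integral_integral_swap hint
  have hl : ∀ t ∈ Ioc a x, ∫ s in Ioc a x, k t s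
      = (x - t) ^ (p - 1) * ∫ s in a..t, (t - s) ^ (q - 1) * h s := by
    intro t ht
    have h1 : k t = (Iio t).indicator
        (fun s => (x - t) ^ (p - 1) * ((t - s) ^ (q - 1) * h s)) := by
      ext s
      simp [hk, indicator, mul_assoc]
    rw [h1, setIntegral_indicator measurableSet_Iio, ← intervalIntegral.integral_const_mul,
      integral_of_le ht.1.le, integral_Ioc_eq_integral_Ioo]
    congr 2
    ext s
    simp only [mem_inter_iff, mem_Ioc, mem_Iio, mem_Ioo]
    exact ⟨fun hs => ⟨hs.1.1, hs.2⟩, fun hs => ⟨⟨hs.1, hs.2.le.trans ht.2⟩, hs.2⟩⟩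
  rw [integral_of_le hax, ← setIntegral_congr_fun measurableSet_Ioc hl, hswap,
    ← intervalIntegral.integral_const_mul, integral_of_le hax]
  refine integral_congr_ae ?_
  filter_upwards [hIoo] with s hs
  simp only [hk]
  rw [setIntegral_Ioc_indicator_Ioi (Ioo_subset_Ioc_self hs),
    intervalIntegral.integral_mul_const, integral_rsub_rpow_mul_sub_rpow hs.2 hp hq]
  ring

theorem RLint_of_pos {α : ℝ} (hα : 0 < α) (a : ℝ) (f : ℝ → ℝ) (x : ℝ) :
    RLint a α f x = (1 / Real.Gamma α) * ∫ t in a..x, (x - t) ^ (α - 1) * f t :=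
  if_neg hα.ne'

theorem RLint_one (a : ℝ) (f : ℝ → ℝ) (x : ℝ) : RLint a 1 f x = ∫ t in a..x, f t := by
  simp [RLint]

theorem RLint_RLint {a x p q : ℝ} {h : ℝ → ℝ} (hax : a ≤ x) (hp : 0 < p) (hq : 0 < q)
    (hpq : 1 ≤ p + q) (hh : IntervalIntegrable h volume a x) :
    RLint a p (RLint a q h) x = RLint a (p + q) h x := by
  have hΓp := (Real.Gamma_pos_of_pos hp).ne'
  have hΓq := (Real.Gamma_pos_of_pos hq).ne'
  have hΓ := (Real.Gamma_pos_of_pos (add_pos hp hq)).ne'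
  simp only [RLint_of_pos hp, RLint_of_pos hq, RLint_of_pos (add_pos hp hq)]
  simp only [mul_left_comm _ (1 / Real.Gamma q)]
  rw [intervalIntegral.integral_const_mul, integral_rsub_rpow_mul_integral hax hp hq hpq hh,
    ProbabilityTheory.beta]
  field_simp

theorem RLint_congr {a α x : ℝ} {f g : ℝ → ℝ} (hα : 0 < α) (hax : a ≤ x)
    (hfg : EqOn f g (Ioc a x)) : RLint a α f x = RLint a α g x := by
  rw [RLint_of_pos hα, RLint_of_pos hα, integral_of_le hax, integral_of_le hax]
  congr 1
  exact setIntegral_congr_fun measurableSet_Ioc fun t ht => by simp only [hfg ht]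

theorem RLint_add {a α x : ℝ} {f g : ℝ → ℝ} (hα : 0 < α)
    (hf : IntervalIntegrable (fun t => (x - t) ^ (α - 1) * f t) volume a x)
    (hg : IntervalIntegrable (fun t => (x - t) ^ (α - 1) * g t) volume a x) :
    RLint a α (fun t => f t + g t) x = RLint a α f x + RLint a α g x := by
  simp only [RLint_of_pos hα, mul_add]
  rw [intervalIntegral.integral_add hf hg, mul_add]

theorem RLint_const {α : ℝ} (hα : 0 < α) (a c x : ℝ) :
    RLint a α (fun _ => c) x = ∫ t in a..x, c / Real.Gamma α * (t - a) ^ (α - 1) := by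
  have h1 := intervalIntegral.integral_comp_sub_left (a := a) (b := x)
    (fun t : ℝ => t ^ (α - 1)) x
  have h2 := intervalIntegral.integral_comp_sub_right (a := a) (b := x)
    (fun t : ℝ => t ^ (α - 1)) a
  simp only [sub_self] at h1 h2
  rw [RLint_of_pos hα, intervalIntegral.integral_mul_const, intervalIntegral.integral_const_mul,
    h1, h2]
  ring

theorem MemCmu.eq_rpow_mul {a b μ : ℝ} {f F : ℝ → ℝ}
    (hF : ∀ x ∈ Ioc a b, F x = (x - a) ^ μ * f x) {x : ℝ} (hx : x ∈ Ioc a b) :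
    f x = (x - a) ^ (-μ) * F x := by
  have h0 : 0 < x - a := sub_pos.2 hx.1
  rw [hF x hx, ← mul_assoc, ← Real.rpow_add h0]
  simp

theorem MemCmu.continuousOn {a b μ : ℝ} {f : ℝ → ℝ} (hf : MemCmu a b μ f) :
    ContinuousOn f (Ioc a b) := by
  obtain ⟨F, hFc, hF⟩ := hf
  refine ContinuousOn.congr (f := fun x => (x - a) ^ (-μ) * F x) ?_
    fun x hx => MemCmu.eq_rpow_mul hF hx
  exact (ContinuousOn.rpow_const (by fun_prop)
    fun t ht => Or.inl (sub_pos.2 ht.1).ne').mul (hFc.mono Ioc_subset_Icc_self)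

theorem MemCmu.intervalIntegrable {a b μ x : ℝ} {f : ℝ → ℝ} (hf : MemCmu a b μ f)
    (hμ : μ < 1) (hx : x ∈ Ioc a b) : IntervalIntegrable f volume a x := by
  obtain ⟨F, hFc, hF⟩ := hf
  have h1 : IntervalIntegrable (fun t => (t - a) ^ ((1 - μ) - 1) * F t) volume a x := by
    refine (intervalIntegrable_sub_rpow (by linarith)).mul_continuousOn ?_
    rw [uIcc_of_le hx.1.le]
    exact hFc.mono (Icc_subset_Icc_right hx.2)
  refine h1.congr fun t ht => ?_
  rw [uIoc_of_le hx.1.le] at ht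
  rw [MemCmu.eq_rpow_mul hF ⟨ht.1, ht.2.trans hx.2⟩]
  ring_nf

theorem MemCmu.rlInt {a b μ α : ℝ} {f : ℝ → ℝ} (hf : MemCmu a b μ f)
    (hμ : μ < 1) (hα : 0 < α) : MemCmu a b (μ - α) (RLint a α f) := by
  obtain ⟨F, hFc, hF⟩ := hf
  have hmem : ∀ y ∈ Icc a b, ∀ u ∈ Icc (0 : ℝ) 1, a + (y - a) * u ∈ Icc a b := by
    intro y hy u hu
    have h0 : 0 ≤ y - a := sub_nonneg.2 hy.1
    exact ⟨by nlinarith [hu.1], by nlinarith [hu.2, hy.2]⟩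
  refine ⟨fun y => (1 / Real.Gamma α) * ∫ u in (0 : ℝ)..1,
    (1 - u) ^ (α - 1) * u ^ (-μ) * F (a + (y - a) * u), ?_, ?_⟩
  · refine ContinuousOn.mul continuousOn_const fun y₀ hy₀ => ?_
    obtain ⟨M, hM⟩ := isCompact_Icc.exists_bound_of_continuousOn hFc
    have hbeta : IntervalIntegrable (fun u : ℝ => (1 - u) ^ (α - 1) * u ^ (-μ)) volume 0 1 := by
      have h := intervalIntegrable_rsub_rpow_mul_sub_rpow (s := 0) (x := 1) zero_lt_one hα
        (show 0 < 1 - μ by linarith)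
      simpa using h
    have hFu : ∀ y ∈ Icc a b, ContinuousOn (fun u => F (a + (y - a) * u)) (Icc 0 1) :=
      fun y hy => hFc.comp (by fun_prop) fun u hu => hmem y hy u hu
    refine intervalIntegral.continuousWithinAt_of_dominated_interval
      (bound := fun u => (1 - u) ^ (α - 1) * u ^ (-μ) * M) ?_ ?_ (hbeta.mul_const M) ?_
    · filter_upwards [self_mem_nhdsWithin] with y hy
      refine (hbeta.mul_continuousOn ?_).aestronglyMeasurable_restrict_uIoc
      rw [uIcc_of_le zero_le_one]
      exact hFu y hy
    · filter_upwards [self_mem_nhdsWithin] with y hy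
      refine ae_of_all _ fun u hu => ?_
      rw [uIoc_of_le zero_le_one] at hu
      have h0 : 0 ≤ 1 - u := sub_nonneg.2 hu.2
      have h1 : 0 ≤ u := hu.1.le
      rw [norm_mul, Real.norm_of_nonneg (by positivity)]
      exact mul_le_mul_of_nonneg_left (hM _ (hmem y hy u (Ioc_subset_Icc_self hu)))
        (by positivity)
    · refine ae_of_all _ fun u hu => ?_
      rw [uIoc_of_le zero_le_one] at hu
      refine ContinuousWithinAt.mul continuousWithinAt_const ?_
      exact (hFc.comp (f := fun y => a + (y - a) * u) (by fun_prop)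
        fun y hy => hmem y hy u (Ioc_subset_Icc_self hu)) y₀ hy₀
  · intro x hx
    have h0 : 0 < x - a := sub_pos.2 hx.1
    rw [RLint_of_pos hα, integral_eq_mul_integral_unit, mul_left_comm]
    dsimp only
    congr 1
    rw [← mul_assoc, ← intervalIntegral.integral_const_mul, integral_of_le zero_le_one,
      integral_of_le zero_le_one]
    refine setIntegral_congr_fun measurableSet_Ioc fun u hu => ?_
    have e1 : x - (a + (x - a) * u) = (x - a) * (1 - u) := by ring
    have e2 : a + (x - a) * u - a = (x - a) * u := by ring
    have hu' : a + (x - a) * u ∈ Ioc a b :=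
      ⟨by nlinarith [hu.1], (hmem x (Ioc_subset_Icc_self hx) u (Ioc_subset_Icc_self hu)).2⟩
    have e3 : (x - a) ^ (μ - α) * (x - a) * ((x - a) ^ (α - 1) * (x - a) ^ (-μ)) = 1 := by
      nth_rewrite 2 [← Real.rpow_one (x - a)]
      rw [← Real.rpow_add h0, ← Real.rpow_add h0, ← Real.rpow_add h0]
      ring_nf
      simp
    simp only [MemCmu.eq_rpow_mul hF hu', e1, e2]
    rw [Real.mul_rpow h0.le (sub_nonneg.2 hu.2), Real.mul_rpow h0.le hu.1.le]
    linear_combination (-((1 - u) ^ (α - 1) * u ^ (-μ) * F (a + (x - a) * u))) * e3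

theorem eqOn_zero_of_integral_eq_zero {a b : ℝ} {k : ℝ → ℝ} (hk : ContinuousOn k (Ioc a b))
    (hint : ∀ x ∈ Ioc a b, IntervalIntegrable k volume a x)
    (h0 : ∀ x ∈ Ioc a b, ∫ t in a..x, k t = 0) : ∀ x ∈ Ioc a b, k x = 0 := by
  intro x hx
  have hnhds : Ioc a b ∈ nhdsWithin x (Iic x) := by
    filter_upwards [self_mem_nhdsWithin, mem_nhdsWithin_of_mem_nhds (Ioi_mem_nhds hx.1)]
      with y hy hay
    exact ⟨hay, le_trans hy hx.2⟩
  have hcont : ContinuousWithinAt k (Iic x) x := (hk x hx).mono_of_mem_nhdsWithin hnhds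
  have hd : HasDerivWithinAt (fun u => ∫ t in a..u, k t) (k x) (Iic x) x :=
    integral_hasDerivWithinAt_right (hint x hx)
      ⟨Ioc a b, hnhds, hk.aestronglyMeasurable measurableSet_Ioc⟩ hcont
  have hz : HasDerivWithinAt (fun u => ∫ t in a..u, k t) 0 (Iic x) x :=
    (hasDerivWithinAt_const x (Iic x) (0 : ℝ)).congr_of_eventuallyEq
      (by filter_upwards [hnhds] with y hy using h0 y hy) (h0 x hx)
  exact (uniqueDiffWithinAt_Iic x).eq_deriv _ hd hz

theorem rl_integral_of_rl_deriv (a b α μ L : ℝ) (f : ℝ → ℝ) (hab : a < b)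
    (hα0 : 0 < α) (hα1 : α < 1) (hμ0 : 0 ≤ μ) (hμ1 : μ < 1)
    (hf : MemCmu a b μ f)
    -- `I_{a+}^{1-α} f ∈ C_μ^1[a,b]`: differentiable on `(a,b]` with derivative in `C_μ[a,b]`
    (hdiff : ∀ x ∈ Set.Ioc a b, DifferentiableAt ℝ (RLint a (1 - α) f) x)
    (hd : MemCmu a b μ (fun x => deriv (RLint a (1 - α) f) x))
    -- `(I_{a+}^{1-α} f)(a+) = L`
    (hL : Tendsto (RLint a (1 - α) f) (nhdsWithin a (Set.Ioi a)) (nhds L)) :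
    ∀ x ∈ Set.Ioc a b,
      RLint a α (fun t => deriv (RLint a (1 - α) f) t) x
        = f x - L / Real.Gamma α * (x - a) ^ (α - 1) := by
  set g := RLint a (1 - α) f
  set d : ℝ → ℝ := fun t => deriv g t with hd_def
  have hdi : ∀ x ∈ Ioc a b, IntervalIntegrable d volume a x :=
    fun x hx => hd.intervalIntegrable hμ1 hx
  have hg : ∀ x ∈ Ioc a b, g x = L + RLint a 1 d x := by
    intro x hx
    have h := integral_eq_sub_of_hasDerivAt_of_tendsto hx.1
      (fun y hy => (hdiff y ⟨hy.1, hy.2.le.trans hx.2⟩).hasDerivAt) (hdi x hx) hL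
      ((hdiff x hx).continuousAt.tendsto.mono_left nhdsWithin_le_nhds)
    rw [RLint_one, hd_def, h]
    ring
  have hId := hd.rlInt hμ1 hα0
  have hIdi : ∀ x ∈ Ioc a b, IntervalIntegrable (RLint a α d) volume a x :=
    fun x hx => hId.intervalIntegrable (by linarith) hx
  have hfi : ∀ x ∈ Ioc a b, IntervalIntegrable f volume a x :=
    fun x hx => hf.intervalIntegrable hμ1 hx
  have hpi : ∀ x, IntervalIntegrable
      (fun t => L / Real.Gamma α * (t - a) ^ (α - 1)) volume a x :=
    fun x => (intervalIntegrable_sub_rpow hα0).const_mul _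
  have hprim : ∀ x ∈ Ioc a b, ∫ t in a..x, f t
      = (∫ t in a..x, L / Real.Gamma α * (t - a) ^ (α - 1)) + ∫ t in a..x, RLint a α d t := by
    intro x hx
    have hker := intervalIntegrable_rsub_rpow (s := a) (x := x) hα0
    have hcont : ContinuousOn (RLint a 1 d) (uIcc a x) := by
      rw [funext (RLint_one a d)]
      exact continuousOn_primitive_interval' (hdi x hx) left_mem_uIcc
    calc ∫ t in a..x, f t = RLint a (α + (1 - α)) f x := by
          rw [add_sub_cancel, RLint_one]
      _ = RLint a α g x :=
          (RLint_RLint hx.1.le hα0 (by linarith) (by linarith) (hfi x hx)).symm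
      _ = RLint a α (fun t => L + RLint a 1 d t) x :=
          RLint_congr hα0 hx.1.le fun t ht => hg t ⟨ht.1, ht.2.trans hx.2⟩
      _ = RLint a α (fun _ => L) x + RLint a α (RLint a 1 d) x :=
          RLint_add hα0 (hker.mul_const L) (hker.mul_continuousOn hcont)
      _ = RLint a α (fun _ => L) x + RLint a 1 (RLint a α d) x := by
          rw [RLint_RLint hx.1.le hα0 one_pos (by linarith) (hdi x hx),
            RLint_RLint hx.1.le one_pos hα0 (by linarith) (hdi x hx), add_comm 1 α]
      _ = _ := by rw [RLint_const hα0, RLint_one]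
  have hzero := eqOn_zero_of_integral_eq_zero (a := a) (b := b)
    (k := fun t => f t - L / Real.Gamma α * (t - a) ^ (α - 1) - RLint a α d t)
    ((hf.continuousOn.sub (continuousOn_const.mul (ContinuousOn.rpow_const (by fun_prop)
      fun t ht => Or.inl (sub_pos.2 ht.1).ne'))).sub hId.continuousOn)
    (fun x hx => ((hfi x hx).sub (hpi x)).sub (hIdi x hx))
    (fun x hx => by
      rw [intervalIntegral.integral_sub ((hfi x hx).sub (hpi x)) (hIdi x hx),
        intervalIntegral.integral_sub (hfi x hx) (hpi x), hprim x hx]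
      ring)
  intro x hx
  linarith [hzero x hx]
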